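/- arXiv:2306.11827 — 3 statements merged into one kernel-verified Lean document; each statement's English description precedes it below -/
import Mathlib

section
/- For every ReLU network N : ℝⁿ → ℝᵐ there exists a shallow network S with exactly 3 hidden layers, whose weights and biases take values in the extended reals (with the convention that (±∞)·0 = 0 and (+∞)·a = +∞ for a > 0) and whose hidden layers apply the componentwise ReLU map t ↦ max(0,t) to extended-real-valued pre-activations, such that S(x) = N(x) for all x ∈ ℝⁿ. -/
open scoped BigOperators

/-- Layer activations of a feed-forward ReLU network: `chi widths W b l x` is `χ^(l)(x)`,
with `χ^(0)(x) = x` and `χ^(l+1)(x) = ReLU(W^(l) χ^(l)(x) + b^(l))` componentwise. -/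
noncomputable def chi (widths : ℕ → ℕ)
    (W : ∀ l : ℕ, Matrix (Fin (widths (l + 1))) (Fin (widths l)) ℝ)
    (b : ∀ l : ℕ, Fin (widths (l + 1)) → ℝ) :
    ∀ l : ℕ, (Fin (widths 0) → ℝ) → Fin (widths l) → ℝ
  | 0 => fun x => x
  | l + 1 => fun x i => max 0 ((W l).mulVec (chi widths W b l x) i + b l i)

/-- Matrix-vector multiplication over the extended reals, where `(±∞) * 0 = 0`
by the convention built into `EReal` multiplication. -/
noncomputable def emulVec {a c : ℕ} (M : Matrix (Fin a) (Fin c) EReal)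
    (x : Fin c → EReal) : Fin a → EReal :=
  fun i => ∑ j, M i j * x j

/-- ReLU on the extended reals: `erelu (⊥) = 0` and `erelu ⊤ = ⊤`. -/
noncomputable def erelu (t : EReal) : EReal := max 0 t

/-- A shallow network with exactly three hidden layers (of widths `k₁, k₂, k₃`) over the
extended reals: `χ^(0)(x) = x`, `χ^(l)(x) = ReLU(W^(l) χ^(l-1)(x) + b^(l))` for `l = 1,2,3`,
and output `W^(4) χ^(3)(x) + b^(4)`. -/
noncomputable def shallow (n m k₁ k₂ k₃ : ℕ)
    (W1 : Matrix (Fin k₁) (Fin n) EReal) (b1 : Fin k₁ → EReal)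
    (W2 : Matrix (Fin k₂) (Fin k₁) EReal) (b2 : Fin k₂ → EReal)
    (W3 : Matrix (Fin k₃) (Fin k₂) EReal) (b3 : Fin k₃ → EReal)
    (W4 : Matrix (Fin m) (Fin k₃) EReal) (b4 : Fin m → EReal)
    (x : Fin n → ℝ) : Fin m → EReal :=
  let χ1 : Fin k₁ → EReal := fun i => erelu (emulVec W1 (fun j => (x j : EReal)) i + b1 i)
  let χ2 : Fin k₂ → EReal := fun i => erelu (emulVec W2 χ1 i + b2 i)
  let χ3 : Fin k₃ → EReal := fun i => erelu (emulVec W3 χ2 i + b3 i)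
  fun i => emulVec W4 χ3 i + b4 i


/-- Real affine function attached to a pair. -/
noncomputable def affv {n : ℕ} (p : (Fin n → ℝ) × ℝ) (x : Fin n → ℝ) : ℝ :=
  ∑ j, p.1 j * x j + p.2

/-- `f` is the maximum of the affine functions in `S`. -/
def MaxOf {n : ℕ} (S : Finset ((Fin n → ℝ) × ℝ)) (f : (Fin n → ℝ) → ℝ) : Prop :=
  ∀ x, (∀ p ∈ S, affv p x ≤ f x) ∧ ∃ p ∈ S, f x = affv p x

def IsMaxAff {n : ℕ} (f : (Fin n → ℝ) → ℝ) : Prop := ∃ S, MaxOf S f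

def IsDiff {n : ℕ} (f : (Fin n → ℝ) → ℝ) : Prop :=
  ∃ F G, IsMaxAff F ∧ IsMaxAff G ∧ ∀ x, f x = F x - G x

section closure
variable {n : ℕ} {f g : (Fin n → ℝ) → ℝ}

lemma affv_add (p q : (Fin n → ℝ) × ℝ) (x) : affv (p + q) x = affv p x + affv q x := by
  simp only [affv, Prod.fst_add, Prod.snd_add, Pi.add_apply, add_mul, Finset.sum_add_distrib]
  ring

lemma affv_smul (c : ℝ) (p : (Fin n → ℝ) × ℝ) (x) : affv (c • p) x = c * affv p x := by
  simp only [affv, Prod.smul_fst, Prod.smul_snd, Pi.smul_apply, smul_eq_mul, mul_add,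
    Finset.mul_sum, mul_assoc]

lemma isMaxAff_aff (p : (Fin n → ℝ) × ℝ) : IsMaxAff (affv p) :=
  ⟨{p}, fun x => by simp⟩

lemma IsMaxAff.add (hf : IsMaxAff f) (hg : IsMaxAff g) : IsMaxAff (fun x => f x + g x) := by
  classical
  obtain ⟨S, hS⟩ := hf
  obtain ⟨T, hT⟩ := hg
  refine ⟨(S ×ˢ T).image (fun z => z.1 + z.2), fun x => ⟨?_, ?_⟩⟩
  · intro p hp
    simp only [Finset.mem_image, Finset.mem_product] at hp
    obtain ⟨z, ⟨h1, h2⟩, rfl⟩ := hp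
    rw [affv_add]
    exact add_le_add ((hS x).1 _ h1) ((hT x).1 _ h2)
  · obtain ⟨p, hp, h1⟩ := (hS x).2
    obtain ⟨q, hq, h2⟩ := (hT x).2
    refine ⟨p + q, ?_, by rw [affv_add, ← h1, ← h2]⟩
    simp only [Finset.mem_image, Finset.mem_product]
    exact ⟨(p, q), ⟨hp, hq⟩, rfl⟩

lemma IsMaxAff.smul (hf : IsMaxAff f) {c : ℝ} (hc : 0 ≤ c) : IsMaxAff (fun x => c * f x) := by
  classical
  obtain ⟨S, hS⟩ := hf
  refine ⟨S.image (fun z => c • z), fun x => ⟨?_, ?_⟩⟩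
  · intro p hp
    simp only [Finset.mem_image] at hp
    obtain ⟨z, h1, rfl⟩ := hp
    rw [affv_smul]
    exact mul_le_mul_of_nonneg_left ((hS x).1 _ h1) hc
  · obtain ⟨p, hp, h1⟩ := (hS x).2
    exact ⟨c • p, Finset.mem_image_of_mem _ hp, by rw [affv_smul, ← h1]⟩

lemma IsMaxAff.max (hf : IsMaxAff f) (hg : IsMaxAff g) :
    IsMaxAff (fun x => Max.max (f x) (g x)) := by
  classical
  obtain ⟨S, hS⟩ := hf
  obtain ⟨T, hT⟩ := hg
  refine ⟨S ∪ T, fun x => ⟨?_, ?_⟩⟩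
  · intro p hp
    rcases Finset.mem_union.1 hp with h | h
    · exact le_max_of_le_left ((hS x).1 _ h)
    · exact le_max_of_le_right ((hT x).1 _ h)
  · obtain ⟨p, hp, h1⟩ := (hS x).2
    obtain ⟨q, hq, h2⟩ := (hT x).2
    rcases le_total (f x) (g x) with h | h
    · exact ⟨q, Finset.mem_union_right _ hq, by rw [← h2]; exact max_eq_right h⟩
    · exact ⟨p, Finset.mem_union_left _ hp, by rw [← h1]; exact max_eq_left h⟩

lemma isDiff_aff (p : (Fin n → ℝ) × ℝ) : IsDiff (affv p) :=
  ⟨affv p, affv 0, isMaxAff_aff p, isMaxAff_aff 0, fun x => by simp [affv]⟩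

lemma isDiff_const (c : ℝ) : IsDiff (fun _ : Fin n → ℝ => c) := by
  have := isDiff_aff (n := n) (0, c)
  convert this using 2
  simp [affv]

lemma isDiff_coord (j : Fin n) : IsDiff (fun x : Fin n → ℝ => x j) := by
  have := isDiff_aff (n := n) (Pi.single j 1, 0)
  convert this using 2
  simp [affv, Pi.single_apply]

lemma IsDiff.add (hf : IsDiff f) (hg : IsDiff g) : IsDiff (fun x => f x + g x) := by
  obtain ⟨F, G, hF, hG, h⟩ := hf
  obtain ⟨F', G', hF', hG', h'⟩ := hg
  exact ⟨_, _, hF.add hF', hG.add hG', fun x => by simp only [h, h']; ring⟩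

lemma IsDiff.smul (hf : IsDiff f) (c : ℝ) : IsDiff (fun x => c * f x) := by
  obtain ⟨F, G, hF, hG, h⟩ := hf
  rcases le_total 0 c with hc | hc
  · exact ⟨_, _, hF.smul hc, hG.smul hc, fun x => by simp only [h]; ring⟩
  · have hc' : 0 ≤ -c := by linarith
    exact ⟨_, _, hG.smul hc', hF.smul hc', fun x => by simp only [h]; ring⟩

lemma IsDiff.relu (hf : IsDiff f) : IsDiff (fun x => Max.max 0 (f x)) := by
  obtain ⟨F, G, hF, hG, h⟩ := hf
  refine ⟨_, _, hG.max hF, hG, fun x => ?_⟩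
  simp only [h]
  rcases le_total (G x) (F x) with h | h <;> simp [h]

lemma isDiff_sum {κ : Type*} (s : Finset κ) (u : κ → (Fin n → ℝ) → ℝ)
    (h : ∀ k, IsDiff (u k)) : IsDiff (fun x => ∑ k ∈ s, u k x) := by
  classical
  induction s using Finset.induction_on with
  | empty => simpa using isDiff_const (n := n) 0
  | insert a s ha ih =>
    simp only [Finset.sum_insert ha]
    exact (h a).add ih
end closure

lemma isDiff_chi (widths : ℕ → ℕ)
    (W : ∀ l : ℕ, Matrix (Fin (widths (l + 1))) (Fin (widths l)) ℝ)
    (b : ∀ l : ℕ, Fin (widths (l + 1)) → ℝ) (l : ℕ) :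
    ∀ i, IsDiff (fun x => chi widths W b l x i) := by
  induction l with
  | zero => intro i; exact isDiff_coord i
  | succ l ih =>
    intro i
    simp only [chi, Matrix.mulVec, dotProduct]
    exact ((isDiff_sum _ _ fun k => (ih k).smul _).add (isDiff_const _)).relu

section units
variable {κ : Type*} [Fintype κ]

lemma unit_kill (M : κ → EReal) (r : κ → ℝ) (β : EReal)
    (h : β = ⊥ ∨ ∃ k, M k = ⊥ ∧ 0 < r k) :
    erelu (∑ k, M k * (r k : EReal) + β) = ((0 : ℝ) : EReal) := by
  classical
  have : ∑ k, M k * (r k : EReal) + β = ⊥ := by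
    rcases h with rfl | ⟨k, hk, hr⟩
    · simp
    · rw [← Finset.add_sum_erase _ _ (Finset.mem_univ k), hk, EReal.bot_mul_coe_of_pos hr,
        EReal.bot_add, EReal.bot_add]
  rw [this]; simp [erelu]

lemma coe_sum' (y : κ → ℝ) : ((∑ k, y k : ℝ) : EReal) = ∑ k, (y k : EReal) :=
  map_sum (⟨⟨Real.toEReal, rfl⟩, EReal.coe_add⟩ : ℝ →+ EReal) y Finset.univ

lemma unit_live (M : κ → EReal) (r : κ → ℝ) (β : ℝ) (y : κ → ℝ)
    (h : ∀ k, M k * (r k : EReal) = (y k : EReal)) :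
    erelu (∑ k, M k * (r k : EReal) + (β : EReal)) = ((max 0 (∑ k, y k + β) : ℝ) : EReal) := by
  simp only [h, ← coe_sum', ← EReal.coe_add]
  rw [erelu, EReal.coe_strictMono.monotone.map_max, EReal.coe_zero]
end units

lemma transfer {n m : ℕ} {κ₁ κ₂ κ₃ : Type} [Fintype κ₁] [Fintype κ₂] [Fintype κ₃]
    (W1 : κ₁ → Fin n → EReal) (b1 : κ₁ → EReal)
    (W2 : κ₂ → κ₁ → EReal) (b2 : κ₂ → EReal)
    (W3 : κ₃ → κ₂ → EReal) (b3 : κ₃ → EReal)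
    (W4 : Fin m → κ₃ → EReal) (b4 : Fin m → EReal)
    (R1 : (Fin n → ℝ) → κ₁ → ℝ) (R2 : (Fin n → ℝ) → κ₂ → ℝ) (R3 : (Fin n → ℝ) → κ₃ → ℝ)
    (N : (Fin n → ℝ) → Fin m → EReal)
    (h1 : ∀ x k, erelu (∑ j, W1 k j * (x j : EReal) + b1 k) = (R1 x k : EReal))
    (h2 : ∀ x k, erelu (∑ j, W2 k j * (R1 x j : EReal) + b2 k) = (R2 x k : EReal))
    (h3 : ∀ x k, erelu (∑ j, W3 k j * (R2 x j : EReal) + b3 k) = (R3 x k : EReal))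
    (h4 : ∀ x i, ∑ j, W4 i j * (R3 x j : EReal) + b4 i = N x i) :
    ∃ (k₁ k₂ k₃ : ℕ)
      (W1 : Matrix (Fin k₁) (Fin n) EReal) (b1 : Fin k₁ → EReal)
      (W2 : Matrix (Fin k₂) (Fin k₁) EReal) (b2 : Fin k₂ → EReal)
      (W3 : Matrix (Fin k₃) (Fin k₂) EReal) (b3 : Fin k₃ → EReal)
      (W4 : Matrix (Fin m) (Fin k₃) EReal) (b4 : Fin m → EReal),
      ∀ (x : Fin n → ℝ) (i : Fin m),
        shallow n m k₁ k₂ k₃ W1 b1 W2 b2 W3 b3 W4 b4 x i = N x i := by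
  let e1 := (Fintype.equivFin κ₁).symm
  let e2 := (Fintype.equivFin κ₂).symm
  let e3 := (Fintype.equivFin κ₃).symm
  refine ⟨_, _, _, fun k j => W1 (e1 k) j, fun k => b1 (e1 k),
    fun k j => W2 (e2 k) (e1 j), fun k => b2 (e2 k),
    fun k j => W3 (e3 k) (e2 j), fun k => b3 (e3 k),
    fun i j => W4 i (e3 j), b4, fun x i => ?_⟩
  simp only [shallow, emulVec, h1]
  have s2 : ∀ k, ∑ j, W2 k (e1 j) * (R1 x (e1 j) : EReal) = ∑ j, W2 k j * (R1 x j : EReal) :=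
    fun k => Equiv.sum_comp e1 (fun j => W2 k j * (R1 x j : EReal))
  simp only [s2, h2]
  have s3 : ∀ k, ∑ j, W3 k (e2 j) * (R2 x (e2 j) : EReal) = ∑ j, W3 k j * (R2 x j : EReal) :=
    fun k => Equiv.sum_comp e2 (fun j => W3 k j * (R2 x j : EReal))
  simp only [s3, h3]
  rw [← h4]
  congr 1
  exact Equiv.sum_comp e3 (fun j => W4 i j * (R3 x j : EReal))

/-- sign of a boolean -/
def sg (s : Bool) : ℝ := if s then 1 else -1

open Classical in
lemma core {n m K : ℕ} {G : Type} [Fintype G] (p : Fin K → (Fin n → ℝ) × ℝ)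
    (S : G → Fin K → Prop) (F : G → (Fin n → ℝ) → ℝ)
    (hle : ∀ g x j, S g j → affv (p j) x ≤ F g x)
    (hex : ∀ g x, ∃ j, S g j ∧ F g x = affv (p j) x)
    (C : Fin m → G → ℝ) :
    ∃ (k₁ k₂ k₃ : ℕ)
      (W1 : Matrix (Fin k₁) (Fin n) EReal) (b1 : Fin k₁ → EReal)
      (W2 : Matrix (Fin k₂) (Fin k₁) EReal) (b2 : Fin k₂ → EReal)
      (W3 : Matrix (Fin k₃) (Fin k₂) EReal) (b3 : Fin k₃ → EReal)
      (W4 : Matrix (Fin m) (Fin k₃) EReal) (b4 : Fin m → EReal),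
      ∀ (x : Fin n → ℝ) (i : Fin m),
        shallow n m k₁ k₂ k₃ W1 b1 W2 b2 W3 b3 W4 b4 x i
          = ((∑ g, C i g * F g x : ℝ) : EReal) := by
  let q : (Fin K × Fin K) ⊕ (Fin K × Bool) → (Fin n → ℝ) × ℝ :=
    Sum.elim (fun z => p z.2 + (-1 : ℝ) • p z.1) (fun z => sg z.2 • p z.1)
  let mx : G → (Fin n → ℝ) → Fin K → Prop := fun g x j => S g j ∧ F g x = affv (p j) x
  refine transfer (κ₁ := (Fin K × Fin K) ⊕ (Fin K × Bool))
    (κ₂ := (G × Fin K) × Option Bool) (κ₃ := (G × Fin K) × Bool)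
    (fun k j => ((q k).1 j : EReal)) (fun k => ((q k).2 : EReal))
    (fun k => Sum.elim
      (fun z => if z.1 = k.1.2 ∧ S k.1.1 z.2 then ⊥ else 0)
      (fun z => if z.1 = k.1.2 then
        ((k.2.elim 0 (fun s => sg s * sg z.2) : ℝ) : EReal) else 0))
    (fun k => if S k.1.1 k.1.2 then ((k.2.elim 1 (fun _ => 0) : ℝ) : EReal) else ⊥)
    (fun k z => if z.1.1 = k.1.1 ∧ z.1.2 < k.1.2 ∧ z.2 = none then ⊥ else
      if z = (k.1, some k.2) then 1 else 0)
    (fun _ => ((0 : ℝ) : EReal))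
    (fun i z => ((C i z.1.1 * sg z.2 : ℝ) : EReal)) (fun _ => 0)
    (fun x k => max 0 (affv (q k) x))
    (fun x k => if mx k.1.1 x k.1.2 then
      k.2.elim 1 (fun s => max 0 (sg s * affv (p k.1.2) x)) else 0)
    (fun x k => if mx k.1.1 x k.1.2 ∧ ∀ l < k.1.2, ¬ mx k.1.1 x l then
      max 0 (sg k.2 * affv (p k.1.2) x) else 0)
    _ ?_ ?_ ?_ ?_
  · intro x k
    rw [unit_live _ _ _ (fun j => (q k).1 j * x j) (fun j => by rw [EReal.coe_mul])]
    rfl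
  · rintro x ⟨⟨g, j⟩, c⟩
    dsimp only
    by_cases hm : mx g x j
    · rw [if_pos hm, if_pos hm.1]
      rw [unit_live _ _ _ (Sum.elim (fun _ => 0) (fun z => if z.1 = j then
        c.elim 0 (fun s => sg s * sg z.2) * max 0 (sg z.2 * affv (p j) x) else 0))]
      · congr 1
        rcases c with _ | s
        · simp [Fintype.sum_sum_type]
        · simp only [Fintype.sum_sum_type, Sum.elim_inl, Sum.elim_inr, Fintype.sum_prod_type,
            Option.elim, Finset.sum_const_zero, zero_add, add_zero]
          congr 1
          rw [Finset.sum_eq_single j]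
          · simp only [if_true, Fintype.sum_bool, sg]
            rcases le_total 0 (affv (p j) x) with h | h <;> cases s <;> simp [h]
          · intro b _ hb; simp [hb]
          · simp
      · rintro (⟨a, l⟩ | ⟨a, s⟩)
        · simp only [Sum.elim_inl]
          split_ifs with h
          · obtain ⟨rfl, hl⟩ := h
            have h1 : affv (q (Sum.inl (a, l))) x ≤ 0 := by
              have := hle g x l hl
              have h2 := hm.2
              simp only [q, Sum.elim_inl, affv_add, affv_smul]
              linarith
            rw [max_eq_left h1]; simp
          · simp
        · simp only [Sum.elim_inr]
          split_ifs with h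
          · subst h
            rw [EReal.coe_mul]
            simp only [q, Sum.elim_inr, affv_smul]
          · simp
    · rw [if_neg hm]
      apply unit_kill
      by_cases hS : S g j
      · right
        obtain ⟨l, hl, hF⟩ := hex g x
        refine ⟨Sum.inl (j, l), by simp [hl], ?_⟩
        simp only [q, Sum.elim_inl, affv_add, affv_smul]
        have h1 := hle g x j hS
        have h2 : F g x ≠ affv (p j) x := fun h => hm ⟨hS, h⟩
        have h3 := lt_of_le_of_ne h1 (Ne.symm h2)
        apply lt_max_of_lt_right
        linarith
      · left; simp [hS]
  · rintro x ⟨⟨g, j⟩, s⟩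
    dsimp only
    by_cases hf : ∀ l < j, ¬ mx g x l
    · rw [unit_live _ _ _ (fun z => if z = ((g, j), some s) then
        (if mx g x j then max 0 (sg s * affv (p j) x) else 0) else 0)]
      · congr 1
        rw [Finset.sum_ite_eq' ]
        by_cases hm : mx g x j
        · rw [if_pos (Finset.mem_univ _), if_pos hm, if_pos ⟨hm, hf⟩]; simp
        · simp [hm]
      · rintro ⟨⟨g', l⟩, c⟩
        dsimp only
        split_ifs with h1 h2 h3 h4 h5 h6 <;> simp_all
    · rw [if_neg (fun h => hf h.2)]
      apply unit_kill
      right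
      push Not at hf
      obtain ⟨l, hl, hm⟩ := hf
      exact ⟨((g, l), none), by simp [hl], by simp [hm]⟩
  · intro x i
    simp only [← EReal.coe_mul, ← coe_sum', add_zero]
    congr 1
    rw [Fintype.sum_prod_type, Fintype.sum_prod_type]
    refine Finset.sum_congr rfl fun g _ => ?_
    have hn : ∃ j, mx g x j := hex g x
    obtain ⟨j, hj, hmin⟩ : ∃ j, mx g x j ∧ ∀ l < j, ¬ mx g x l := by
      obtain ⟨j, hj, h⟩ := WellFounded.has_min (wellFounded_lt (α := Fin K)) {j | mx g x j} hn
      exact ⟨j, hj, fun l hl hm => h l hm hl⟩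
    rw [Finset.sum_eq_single j]
    · simp only [Fintype.sum_bool]
      rw [if_pos ⟨hj, hmin⟩, if_pos ⟨hj, hmin⟩, hj.2]
      simp only [sg]
      rcases le_total 0 (affv (p j) x) with h | h <;> simp [h]
    · intro l _ hl
      simp only [Fintype.sum_bool]
      have : ¬ (mx g x l ∧ ∀ l' < l, ¬ mx g x l') := by
        rintro ⟨h1, h2⟩
        rcases lt_or_gt_of_ne hl with h | h
        · exact hmin l h h1
        · exact h2 j h hj
      rw [if_neg this, if_neg this]; simp
    · simp

/-- Every deep ReLU network `N : ℝⁿ → ℝᵐ` (with `L` hidden layers, real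
weights `W`, biases `b`, and output layer `Wout, bout`) is functionally identical to some
shallow network with exactly three hidden layers whose weights and biases are extended reals. -/
theorem deep_relu_network_equals_shallow_ereal_network
    (m L : ℕ) (widths : ℕ → ℕ)
    (W : ∀ l : ℕ, Matrix (Fin (widths (l + 1))) (Fin (widths l)) ℝ)
    (b : ∀ l : ℕ, Fin (widths (l + 1)) → ℝ)
    (Wout : Matrix (Fin m) (Fin (widths L)) ℝ) (bout : Fin m → ℝ) :
    ∃ (k₁ k₂ k₃ : ℕ)
      (W1 : Matrix (Fin k₁) (Fin (widths 0)) EReal) (b1 : Fin k₁ → EReal)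
      (W2 : Matrix (Fin k₂) (Fin k₁) EReal) (b2 : Fin k₂ → EReal)
      (W3 : Matrix (Fin k₃) (Fin k₂) EReal) (b3 : Fin k₃ → EReal)
      (W4 : Matrix (Fin m) (Fin k₃) EReal) (b4 : Fin m → EReal),
      ∀ (x : Fin (widths 0) → ℝ) (i : Fin m),
        shallow (widths 0) m k₁ k₂ k₃ W1 b1 W2 b2 W3 b3 W4 b4 x i
          = ((Wout.mulVec (chi widths W b L x) i + bout i : ℝ) : EReal) := by
  classical
  have hN : ∀ i, IsDiff (fun x => Wout.mulVec (chi widths W b L x) i + bout i) := by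
    intro i
    simp only [Matrix.mulVec, dotProduct]
    exact (isDiff_sum _ _ fun k => (isDiff_chi widths W b L k).smul _).add (isDiff_const _)
  choose F G hF hG hFG using hN
  choose SF hSF using hF
  choose SG hSG using hG
  let S : Fin m ⊕ Fin m → Finset ((Fin (widths 0) → ℝ) × ℝ) := Sum.elim SF SG
  let H : Fin m ⊕ Fin m → (Fin (widths 0) → ℝ) → ℝ := Sum.elim F G
  have hH : ∀ g, MaxOf (S g) (H g) := by
    rintro (i | i)
    · exact hSF i
    · exact hSG i
  let U := Finset.univ.biUnion S
  let e := U.equivFin.symm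
  have key := core (fun j => ((e j : U) : (Fin (widths 0) → ℝ) × ℝ))
    (fun g j => ((e j : U) : (Fin (widths 0) → ℝ) × ℝ) ∈ S g) H
    (fun g x j hj => (hH g x).1 _ hj)
    (fun g x => by
      obtain ⟨p, hp, h⟩ := (hH g x).2
      have hU : p ∈ U := Finset.mem_biUnion.2 ⟨g, Finset.mem_univ _, hp⟩
      refine ⟨e.symm ⟨p, hU⟩, ?_, ?_⟩
      · simpa using hp
      · simpa using h)
    (fun i : Fin m => Sum.elim (fun i' => if i = i' then (1 : ℝ) else 0)
      (fun i' => if i = i' then (-1 : ℝ) else 0))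
  obtain ⟨k₁, k₂, k₃, W1, b1, W2, b2, W3, b3, W4, b4, h⟩ := key
  refine ⟨k₁, k₂, k₃, W1, b1, W2, b2, W3, b3, W4, b4, fun x i => ?_⟩
  rw [h]
  refine Eq.trans ?_ (congrArg Real.toEReal (hFG i x).symm)
  congr 1
  simp [Fintype.sum_sum_type, H, sub_eq_add_neg]
end

section
/- For every continuous function f : ℝⁿ → ℝᵐ that is piecewise linear in the sense that there is a finite partition of ℝⁿ into parts, each part being a finite intersection of (open or closed) half-spaces, on each of which f agrees with an affine map, there exists a shallow network S with 3 hidden layers over the extended reals such that S(x) = f(x) for all x ∈ ℝⁿ. -/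
open scoped BigOperators

/-- A set is a finite intersection of (open or closed) half-spaces of `ℝⁿ`. -/
def IsFiniteHalfspaceIntersection {n : ℕ} (s : Set (Fin n → ℝ)) : Prop :=
  ∃ (k : ℕ) (a : Fin k → Fin n → ℝ) (c : Fin k → ℝ) (strict : Fin k → Bool),
    s = ⋂ i : Fin k,
      {x | if strict i then c i < ∑ j, a i j * x j else c i ≤ ∑ j, a i j * x j}

theorem net_reindex {n m : ℕ} {K1 K2 K3 : Type} [Fintype K1] [Fintype K2] [Fintype K3]
    (W1 : K1 → Fin n → EReal) (b1 : K1 → EReal)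
    (W2 : K2 → K1 → EReal) (b2 : K2 → EReal)
    (W3 : K3 → K2 → EReal) (b3 : K3 → EReal)
    (W4 : Fin m → K3 → EReal) (b4 : Fin m → EReal) (F : (Fin n → ℝ) → Fin m → EReal)
    (h : ∀ x i, ∑ q3, W4 i q3 * erelu (∑ q2, W3 q3 q2 * erelu (∑ q1, W2 q2 q1 *
      erelu (∑ j, W1 q1 j * (x j : EReal) + b1 q1) + b2 q2) + b3 q3) + b4 i = F x i) :
    ∃ (k₁ k₂ k₃ : ℕ)
      (W1 : Matrix (Fin k₁) (Fin n) EReal) (b1 : Fin k₁ → EReal)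
      (W2 : Matrix (Fin k₂) (Fin k₁) EReal) (b2 : Fin k₂ → EReal)
      (W3 : Matrix (Fin k₃) (Fin k₂) EReal) (b3 : Fin k₃ → EReal)
      (W4 : Matrix (Fin m) (Fin k₃) EReal) (b4 : Fin m → EReal),
      ∀ (x : Fin n → ℝ) (i : Fin m),
        shallow n m k₁ k₂ k₃ W1 b1 W2 b2 W3 b3 W4 b4 x i = F x i := by
  let e1 := (Fintype.equivFin K1).symm
  let e2 := (Fintype.equivFin K2).symm
  let e3 := (Fintype.equivFin K3).symm
  refine ⟨_, _, _, fun i j => W1 (e1 i) j, fun i => b1 (e1 i),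
    fun i j => W2 (e2 i) (e1 j), fun i => b2 (e2 i),
    fun i j => W3 (e3 i) (e2 j), fun i => b3 (e3 i),
    fun i j => W4 i (e3 j), b4, fun x i => ?_⟩
  rw [← h x i]
  simp only [shallow, emulVec]
  rw [← Equiv.sum_comp e3]
  congr 1
  refine Finset.sum_congr rfl fun q3 _ => ?_
  rw [← Equiv.sum_comp e2]
  congr 3
  refine Finset.sum_congr rfl fun q2 _ => ?_
  rw [← Equiv.sum_comp e1]

theorem coe_affine {n : ℕ} (w : Fin n → ℝ) (b : ℝ) (x : Fin n → ℝ) :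
    erelu (∑ j, (w j : EReal) * (x j : EReal) + (b : EReal))
      = ((max 0 (∑ j, w j * x j + b) : ℝ) : EReal) := by
  have : ∑ j, (w j : EReal) * (x j : EReal) = ((∑ j, w j * x j : ℝ) : EReal) := by
    induction (Finset.univ : Finset (Fin n)) using Finset.induction_on with
    | empty => simp
    | insert a s ha ih => rw [Finset.sum_insert ha, Finset.sum_insert ha, ih]; push_cast; rfl
  rw [this, erelu, ← EReal.coe_add]
  exact (EReal.coe_strictMono.monotone.map_max (a := (0:ℝ))).symm

theorem sum_diag {ι : Type} [Fintype ι] (w g : ι → EReal) (q : ι)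
    (hw : ∀ q', q' ≠ q → w q' = 0) : ∑ i, w i * g i = w q * g q :=
  Fintype.sum_eq_single q fun q' h => by rw [hw q' h, zero_mul]

theorem sum_pair {p m : ℕ} (g : Fin p × Fin m × Bool → EReal) (j : Fin p) (i : Fin m)
    (h1 : ∀ j' i' s, j' ≠ j → g (j', i', s) = 0) (h2 : ∀ j' i' s, i' ≠ i → g (j', i', s) = 0) :
    ∑ q, g q = g (j, i, true) + g (j, i, false) := by
  simp only [Fintype.sum_prod_type]
  rw [Finset.sum_eq_single j (by intro b _ hb; simp [h1 _ _ _ hb]) (by simp),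
    Finset.sum_eq_single i (by intro b _ hb; simp [h2 _ _ _ hb]) (by simp)]
  simp

theorem sum_bot {ι : Type} [Fintype ι] (v : ι → EReal) (w : ι → EReal)
    (q : ι) (hw : w q = ⊥) (hv : 0 < v q) : ∑ i, w i * v i = ⊥ := by
  classical
  rw [← Finset.add_sum_erase _ _ (Finset.mem_univ q), hw, EReal.bot_mul_of_pos hv, EReal.bot_add]

theorem continuous_pwl_equals_shallow_network
    (n m : ℕ) (f : (Fin n → ℝ) → Fin m → ℝ) (hcont : Continuous f)
    (p : ℕ) (ω : Fin p → Set (Fin n → ℝ))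
    (hpoly : ∀ j, IsFiniteHalfspaceIntersection (ω j))
    (hcover : ∀ x, ∃ j, x ∈ ω j)
    (hdisj : ∀ j j', j ≠ j' → Disjoint (ω j) (ω j'))
    (α : Fin p → Matrix (Fin m) (Fin n) ℝ) (β : Fin p → Fin m → ℝ)
    (haff : ∀ j, ∀ x ∈ ω j, ∀ i, f x i = (α j).mulVec x i + β j i) :
    ∃ (k₁ k₂ k₃ : ℕ)
      (W1 : Matrix (Fin k₁) (Fin n) EReal) (b1 : Fin k₁ → EReal)
      (W2 : Matrix (Fin k₂) (Fin k₁) EReal) (b2 : Fin k₂ → EReal)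
      (W3 : Matrix (Fin k₃) (Fin k₂) EReal) (b3 : Fin k₃ → EReal)
      (W4 : Matrix (Fin m) (Fin k₃) EReal) (b4 : Fin m → EReal),
      ∀ (x : Fin n → ℝ) (i : Fin m),
        shallow n m k₁ k₂ k₃ W1 b1 W2 b2 W3 b3 W4 b4 x i = ((f x i : ℝ) : EReal) := by
  classical
  choose k a c st hω using hpoly
  let H := Σ j : Fin p, Fin (k j)
  let Q := Fin p × Fin m × Bool
  let w1 : H ⊕ Q → Fin n → ℝ := Sum.elim
    (fun h j => if st h.1 h.2 then a h.1 h.2 j else - a h.1 h.2 j)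
    (fun q j => if q.2.2 then α q.1 q.2.1 j else - α q.1 q.2.1 j)
  let c1 : H ⊕ Q → ℝ := Sum.elim
    (fun h => if st h.1 h.2 then - c h.1 h.2 else c h.1 h.2)
    (fun q => if q.2.2 then β q.1 q.2.1 else - β q.1 q.2.1)
  let d2 : H ⊕ Q → EReal := Sum.elim (fun h => if st h.1 h.2 then ⊥ else 1) (fun _ => 1)
  let b2 : H ⊕ Q → EReal := Sum.elim (fun h => if st h.1 h.2 then 1 else 0) (fun _ => 0)
  let W3 : Q → H ⊕ Q → EReal := fun q => Sum.elim (fun h => if h.1 = q.1 then ⊥ else 0)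
    (fun q' => if q' = q then 1 else 0)
  refine net_reindex (fun q j => (w1 q j : EReal)) (fun q => (c1 q : EReal))
    (fun q q' => if q' = q then d2 q else 0) b2 W3 (fun _ => 0)
    (fun i q => if q.2.1 = i then (if q.2.2 then 1 else -1) else 0) (fun _ => 0) _
    fun x i => ?_
  have hd : ∀ (g : H ⊕ Q → EReal) (q : H ⊕ Q),
      ∑ q', (if q' = q then d2 q else 0) * g q' = d2 q * g q := fun g q => by
    rw [sum_diag (fun q' => if q' = q then d2 q else 0) g q (fun q' h => if_neg h), if_pos rfl]
  simp only [coe_affine, hd, add_zero]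
  set v : H ⊕ Q → EReal := fun q2 =>
    erelu (d2 q2 * ((max 0 (∑ j, w1 q2 j * x j + c1 q2) : ℝ) : EReal) + b2 q2) with hv
  -- violation property
  have hviol : ∀ h : H, (0 ≤ v (Sum.inl h)) ∧ (v (Sum.inl h) = 0 ↔
      x ∈ {x | if st h.1 h.2 then c h.1 h.2 < ∑ j, a h.1 h.2 j * x j
        else c h.1 h.2 ≤ ∑ j, a h.1 h.2 j * x j}) := by
    intro h
    refine ⟨le_max_left _ _, ?_⟩
    by_cases hs : st h.1 h.2 = true
    · simp only [hv, w1, c1, d2, b2, Sum.elim_inl, hs, if_true, Set.mem_ofPred_eq]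
      rcases lt_or_ge (c h.1 h.2) (∑ j, a h.1 h.2 j * x j) with hlt | hge
      · have h0 : (0 : ℝ) < max 0 (∑ j, a h.1 h.2 j * x j + - c h.1 h.2) :=
          lt_max_of_lt_right (by linarith)
        rw [EReal.bot_mul_of_pos (by exact_mod_cast h0), EReal.bot_add]
        simp [erelu, hlt]
      · rw [max_eq_left (by linarith)]
        simp [erelu, not_lt.mpr hge]
    · simp only [hv, w1, c1, d2, b2, Sum.elim_inl, hs, Set.mem_ofPred_eq]
      simp only [Bool.false_eq_true, if_false, one_mul, add_zero, neg_mul, Finset.sum_neg_distrib]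
      rw [erelu, max_eq_right (by exact_mod_cast le_max_left _ _)]
      rw [← EReal.coe_zero, EReal.coe_eq_coe_iff, max_eq_left_iff]
      constructor <;> intro h <;> linarith
  have hmem : ∀ j, x ∈ ω j ↔ ∀ i, v (Sum.inl ⟨j, i⟩) = 0 := by
    intro j
    rw [hω j, Set.mem_iInter]
    exact forall_congr' fun i => (hviol ⟨j, i⟩).2.symm
  have hQ : ∀ q : Q, v (Sum.inr q) =
      ((max 0 (if q.2.2 then (α q.1).mulVec x q.2.1 + β q.1 q.2.1
        else -((α q.1).mulVec x q.2.1 + β q.1 q.2.1)) : ℝ) : EReal) := by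
    intro q
    simp only [hv, w1, c1, d2, b2, Sum.elim_inr, one_mul, add_zero]
    rw [erelu, max_eq_right (by exact_mod_cast le_max_left _ _)]
    congr 2
    split_ifs <;> simp [Matrix.mulVec, dotProduct, add_comm]
  have h3 : ∀ q : Q, erelu (∑ q2, W3 q q2 * v q2) =
      if x ∈ ω q.1 then v (Sum.inr q) else 0 := by
    intro q
    split_ifs with hx
    · rw [Fintype.sum_sum_type]
      have h1 : ∑ h : H, W3 q (Sum.inl h) * v (Sum.inl h) = 0 := by
        refine Finset.sum_eq_zero fun h _ => ?_
        obtain ⟨j, i⟩ := h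
        simp only [W3, Sum.elim_inl]
        split_ifs with hj
        · have := (hmem j).1 (hj ▸ hx) i
          rw [this, mul_zero]
        · rw [zero_mul]
      rw [h1, zero_add]
      rw [sum_diag (fun q' => W3 q (Sum.inr q')) (fun q' => v (Sum.inr q')) q
        (fun q' h => by simp [W3, h])]
      have h2 : W3 q (Sum.inr q) = 1 := by simp [W3]
      have h4 : 0 ≤ v (Sum.inr q) := le_max_left _ _
      rw [h2, one_mul]
      exact max_eq_right h4
    · rw [hmem] at hx
      push Not at hx
      obtain ⟨i, hi⟩ := hx
      rw [sum_bot v (W3 q) (Sum.inl ⟨q.1, i⟩) (by simp [W3])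
        (lt_of_le_of_ne (hviol ⟨q.1, i⟩).1 hi.symm)]
      simp [erelu]
  obtain ⟨j, hj⟩ := hcover x
  have hj' : ∀ j', x ∈ ω j' ↔ j' = j := fun j' =>
    ⟨fun h => by_contra fun hne => Set.disjoint_left.1 (hdisj j' j hne) h hj, fun h => h ▸ hj⟩
  change ∑ q : Q, (if q.2.1 = i then (if q.2.2 = true then (1 : EReal) else -1) else 0) *
    erelu (∑ q2, W3 q q2 * v q2) = _
  simp only [h3, hj', hQ]
  rw [haff j x hj i]
  refine (sum_pair _ j i (fun j' i' s h => by simp [h]) (fun j' i' s h => by simp [h])).trans ?_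
  simp only [if_true, one_mul, Bool.false_eq_true, if_false, neg_mul]
  rw [← EReal.coe_neg, ← EReal.coe_add, EReal.coe_eq_coe_iff]
  rcases le_total 0 ((α j).mulVec x i + β j i) with h | h
  · rw [max_eq_right h, max_eq_left (by linarith)]; ring
  · rw [max_eq_left h, max_eq_right (by linarith)]; ring
end

section
/- For a ReLU network N : ℝⁿ → ℝᵐ and any activation pattern P = {P^(1),…,P^(L)}, the set ω_P = {x ∈ ℝⁿ : x has activation pattern P} is a finite intersection of open and closed half-spaces of ℝⁿ; in particular ω_P is convex. -/
open scoped BigOperators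

/-- The activation pattern of `x`: `P^(l)_i = 1 ↔ χ^(l)_i(x) > 0` for hidden layers
`l = 1, …, L`. -/
noncomputable def patternOf (L : ℕ) (widths : ℕ → ℕ)
    (W : ∀ l : ℕ, Matrix (Fin (widths (l + 1))) (Fin (widths l)) ℝ)
    (b : ∀ l : ℕ, Fin (widths (l + 1)) → ℝ)
    (x : Fin (widths 0) → ℝ) :
    ∀ l : Fin L, Fin (widths (l.1 + 1)) → Bool :=
  fun l i => decide (0 < chi widths W b (l.1 + 1) x i)

theorem aux_pre (L : ℕ) (widths : ℕ → ℕ)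
    (W : ∀ l : ℕ, Matrix (Fin (widths (l + 1))) (Fin (widths l)) ℝ)
    (b : ∀ l : ℕ, Fin (widths (l + 1)) → ℝ) (m : ℕ)
    (S : Set (Fin (widths 0) → ℝ))
    (A : Fin (widths m) → Fin (widths 0) → ℝ) (d : Fin (widths m) → ℝ)
    (h : ∀ x ∈ S, ∀ i, chi widths W b m x i = ∑ j, A i j * x j + d i) :
    ∃ (A' : Fin (widths (m + 1)) → Fin (widths 0) → ℝ) (d' : Fin (widths (m + 1)) → ℝ),
      ∀ x ∈ S, ∀ i, (W m).mulVec (chi widths W b m x) i + b m i = ∑ j, A' i j * x j + d' i := by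
  refine ⟨fun i j => ∑ k, W m i k * A k j, fun i => ∑ k, W m i k * d k + b m i, ?_⟩
  intro x hx i
  simp only [Matrix.mulVec, dotProduct, h x hx, mul_add, Finset.sum_add_distrib,
    Finset.sum_mul, Finset.mul_sum]
  rw [Finset.sum_comm]
  simp only [mul_assoc, add_assoc]

theorem aux_chi (L : ℕ) (widths : ℕ → ℕ)
    (W : ∀ l : ℕ, Matrix (Fin (widths (l + 1))) (Fin (widths l)) ℝ)
    (b : ∀ l : ℕ, Fin (widths (l + 1)) → ℝ)
    (P : ∀ l : Fin L, Fin (widths (l.1 + 1)) → Bool) (m : ℕ) (hm : m ≤ L) :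
    ∃ (A : Fin (widths m) → Fin (widths 0) → ℝ) (d : Fin (widths m) → ℝ),
      ∀ x ∈ {x | ∀ l : Fin L, l.1 < m → patternOf L widths W b x l = P l},
        ∀ i, chi widths W b m x i = ∑ j, A i j * x j + d i := by
  induction m with
  | zero =>
    refine ⟨fun i j => if i = j then 1 else 0, fun _ => 0, ?_⟩
    intro x _ i
    simp [chi]
  | succ m ih =>
    obtain ⟨A, d, h⟩ := ih (by omega)
    obtain ⟨A', d', h'⟩ := aux_pre L widths W b m _ A d h
    refine ⟨fun i j => if P ⟨m, hm⟩ i then A' i j else 0,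
      fun i => if P ⟨m, hm⟩ i then d' i else 0, ?_⟩
    intro x hx i
    have h1 := h' x (fun l hl => hx l (by omega)) i
    have h2 := congrFun (hx ⟨m, hm⟩ (by simp)) i
    simp only [patternOf, chi, h1] at h2
    simp only [chi, h1, ← h2]
    by_cases h3 : 0 < ∑ j, A' i j * x j + d' i
    · simp [h3, h3.le]
    · simp [h3, not_lt.mp h3]

theorem aux_half (L : ℕ) (widths : ℕ → ℕ)
    (W : ∀ l : ℕ, Matrix (Fin (widths (l + 1))) (Fin (widths l)) ℝ)
    (b : ∀ l : ℕ, Fin (widths (l + 1)) → ℝ)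
    (P : ∀ l : Fin L, Fin (widths (l.1 + 1)) → Bool) :
    ∃ (k : ℕ) (a : Fin k → Fin (widths 0) → ℝ) (c : Fin k → ℝ) (strict : Fin k → Bool),
      {x | patternOf L widths W b x = P}
        = ⋂ i : Fin k,
            {x | if strict i then c i < ∑ j, a i j * x j else c i ≤ ∑ j, a i j * x j} := by
  have key : ∀ l : Fin L, ∃ (A' : Fin (widths (l.1 + 1)) → Fin (widths 0) → ℝ)
      (d' : Fin (widths (l.1 + 1)) → ℝ),
      ∀ x ∈ {x | ∀ l' : Fin L, l'.1 < l.1 → patternOf L widths W b x l' = P l'},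
        ∀ i, (W l.1).mulVec (chi widths W b l.1 x) i + b l.1 i
          = ∑ j, A' i j * x j + d' i := by
    intro l
    obtain ⟨A, d, h⟩ := aux_chi L widths W b P l.1 l.2.le
    exact aux_pre L widths W b l.1 _ A d h
  choose A d h using key
  let e := Fintype.equivFin (Σ l : Fin L, Fin (widths (l.1 + 1)))
  let a0 : (Σ l : Fin L, Fin (widths (l.1 + 1))) → Fin (widths 0) → ℝ :=
    fun p j => if P p.1 p.2 then A p.1 p.2 j else - A p.1 p.2 j
  let c0 : (Σ l : Fin L, Fin (widths (l.1 + 1))) → ℝ :=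
    fun p => if P p.1 p.2 then - d p.1 p.2 else d p.1 p.2
  refine ⟨_, fun i => a0 (e.symm i), fun i => c0 (e.symm i),
    fun i => P (e.symm i).1 (e.symm i).2, ?_⟩
  have main : ∀ x (l : Fin L),
      (∀ l' : Fin L, l'.1 < l.1 → patternOf L widths W b x l' = P l') → ∀ i,
      (patternOf L widths W b x l i = P l i ↔
        if P l i then c0 ⟨l, i⟩ < ∑ j, a0 ⟨l, i⟩ j * x j
          else c0 ⟨l, i⟩ ≤ ∑ j, a0 ⟨l, i⟩ j * x j) := by
    intro x l hx i
    have h1 := h l x hx i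
    simp only [patternOf, chi, h1, a0, c0]
    cases hP : P l i
    · simp only [decide_eq_false_iff_not, Bool.false_eq_true, if_false, neg_mul,
        Finset.sum_neg_distrib, lt_max_iff, lt_irrefl, false_or, not_lt]
      constructor <;> intro _ <;> linarith
    · simp only [decide_eq_true_eq, if_true, lt_max_iff, lt_irrefl, false_or]
      constructor <;> intro _ <;> linarith
  ext x
  simp only [Set.mem_setOf_eq, Set.mem_iInter]
  constructor
  · intro hx i
    exact (main x (e.symm i).1 (fun l' _ => congrFun hx l') (e.symm i).2).1
      (congrFun (congrFun hx _) _)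
  · intro hx
    have step : ∀ n : ℕ, ∀ l : Fin L, l.1 = n → patternOf L widths W b x l = P l := by
      intro n
      induction n using Nat.strong_induction_on with
      | _ n ih =>
        intro l hl
        funext i
        refine (main x l (fun l' hl' => ih l'.1 (by omega) l' rfl) i).2 ?_
        have := hx (e ⟨l, i⟩)
        rw [e.symm_apply_apply] at this
        exact this
    funext l
    exact step _ l rfl

/-- For any activation pattern `P` of a ReLU network, the region
`ω_P = {x | x has activation pattern P}` is a finite intersection of open and closed
half-spaces of `ℝⁿ`; in particular `ω_P` is convex. -/
theorem pattern_region_is_halfspace_intersection_and_convex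
    (L : ℕ) (widths : ℕ → ℕ)
    (W : ∀ l : ℕ, Matrix (Fin (widths (l + 1))) (Fin (widths l)) ℝ)
    (b : ∀ l : ℕ, Fin (widths (l + 1)) → ℝ)
    (P : ∀ l : Fin L, Fin (widths (l.1 + 1)) → Bool) :
    (∃ (k : ℕ) (a : Fin k → Fin (widths 0) → ℝ) (c : Fin k → ℝ) (strict : Fin k → Bool),
      {x | patternOf L widths W b x = P}
        = ⋂ i : Fin k,
            {x | if strict i then c i < ∑ j, a i j * x j else c i ≤ ∑ j, a i j * x j}) ∧
    Convex ℝ {x | patternOf L widths W b x = P} := by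
  have hh := aux_half L widths W b P
  refine ⟨hh, ?_⟩
  obtain ⟨k, a, c, strict, he⟩ := hh
  rw [he]
  refine convex_iInter fun i => ?_
  have hl : IsLinearMap ℝ (fun x : Fin (widths 0) → ℝ => ∑ j, a i j * x j) := by
    constructor
    · intro x y
      simp [mul_add, Finset.sum_add_distrib]
    · intro r x
      simp only [Pi.smul_apply, smul_eq_mul, Finset.mul_sum]
      exact Finset.sum_congr rfl fun j _ => by ring
  cases strict i
  · simpa using convex_halfSpace_ge hl (c i)
  · simpa using convex_halfSpace_gt hl (c i)
end
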